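/- For every constant c ≥ 1 there exists a constant K > 0 depending only on c such that for every connected d-regular simple graph G on N ≥ 3 vertices with unique marked vertex m, with ℓ = d/N and s = 1 − 1/N, and for every integer t with 0 ≤ t ≤ c·√(HT(P,{m})): ‖W(s)^t |init_ip⟩ − W(P̂(s))^t |init_ip̂⟩‖₂ ≤ K/N^{1/4}. -/

import Mathlib

open scoped BigOperators ComplexConjugate
open Complex

set_option linter.unusedSectionVars false

noncomputable section

namespace LQWPaper

variable {V : Type*} [Fintype V] [DecidableEq V]

/-- The inner product `⟨v,w⟩ = Σᵢ conj (v i) * w i` on `ι → ℂ`. -/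
def cip {ι : Type*} [Fintype ι] (v w : ι → ℂ) : ℂ :=
  ∑ i, (starRingEnd ℂ) (v i) * w i

/-- The `ℓ₂`-norm on `ι → ℂ`. -/
def l2norm {ι : Type*} [Fintype ι] (v : ι → ℂ) : ℝ :=
  Real.sqrt (∑ i, Complex.normSq (v i))

/-- The operator norm (with respect to the `ℓ₂`-norm) of a square matrix. -/
def opNorm {ι : Type*} [Fintype ι] (M : Matrix ι ι ℂ) : ℝ :=
  sSup {r : ℝ | ∃ v : ι → ℂ, l2norm v = 1 ∧ r = l2norm (M.mulVec v)}

/-- A fixed labeling `y_1(x), …, y_d(x)` of the `d` neighbors of each vertex of a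
`d`-regular graph: a bijection from `Fin d` to the neighbor set of each vertex. -/
structure Labeling (G : SimpleGraph V) (d : ℕ) where
  nbr : (x : V) → Fin d ≃ (G.neighborSet x)

lemma Labeling.adj {G : SimpleGraph V} {d : ℕ} (L : Labeling G d) (x : V) (i : Fin d) :
    G.Adj x (L.nbr x i) := (L.nbr x i).prop

/-- The (unique) index of `x` among the neighbors of `y`. -/
def Labeling.idx {G : SimpleGraph V} {d : ℕ} (L : Labeling G d) (y x : V)
    (h : G.Adj y x) : Fin d := (L.nbr y).symm ⟨x, h⟩

/-- The flip-flop shift on basis states: `|x, e_i⟩ ↦ |y, e_j⟩` where `y = y_i(x)` and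
`x = y_j(y)`, and `|x, ↻⟩ ↦ |x, ↻⟩`.  The self-loop is the coin index `Fin.last d`. -/
def shiftFun {G : SimpleGraph V} {d : ℕ} (L : Labeling G d)
    (p : V × Fin (d + 1)) : V × Fin (d + 1) :=
  if h : p.2 = Fin.last d then p
  else
    let i : Fin d := p.2.castPred h
    ⟨L.nbr p.1 i, Fin.castSucc (L.idx (L.nbr p.1 i) p.1 ((L.adj p.1 i).symm))⟩

/-- The flip-flop shift operator `S` as a matrix. -/
def shiftMat {G : SimpleGraph V} {d : ℕ} (L : Labeling G d) :
    Matrix (V × Fin (d + 1)) (V × Fin (d + 1)) ℂ :=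
  Matrix.of fun p q => if p = shiftFun L q then 1 else 0

/-- The coin state `|c⟩ = (1/√(d+ℓ)) (|e_1⟩ + ⋯ + |e_d⟩ + √ℓ |↻⟩)`. -/
def coinVec (d : ℕ) (ℓ : ℝ) : Fin (d + 1) → ℂ :=
  fun a => if a = Fin.last d then ((Real.sqrt ℓ / Real.sqrt (d + ℓ) : ℝ) : ℂ)
           else ((1 / Real.sqrt (d + ℓ) : ℝ) : ℂ)

/-- The coin operator `C = 2|c⟩⟨c| − I`. -/
def coinMat (d : ℕ) (ℓ : ℝ) : Matrix (Fin (d + 1)) (Fin (d + 1)) ℂ :=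
  (2 : ℂ) • Matrix.of (fun a b => coinVec d ℓ a * (starRingEnd ℂ) (coinVec d ℓ b)) - 1

/-- The global coin operator `I_N ⊗ C`. -/
def coinLift (d : ℕ) (ℓ : ℝ) :
    Matrix (V × Fin (d + 1)) (V × Fin (d + 1)) ℂ :=
  Matrix.of fun p q => if p.1 = q.1 then coinMat d ℓ p.2 q.2 else 0

/-- The oracle `G_or = (I_N − 2|m⟩⟨m|) ⊗ I_{d+1}`. -/
def oracleMat (d : ℕ) (m : V) : Matrix (V × Fin (d + 1)) (V × Fin (d + 1)) ℂ :=
  Matrix.of fun p q => if p = q then (if p.1 = m then -1 else 1) else 0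

/-- The lackadaisical quantum walk `U_lazy = S · (I_N ⊗ C) · G_or`. -/
def Ulazy {G : SimpleGraph V} {d : ℕ} (L : Labeling G d) (m : V) (ℓ : ℝ) :
    Matrix (V × Fin (d + 1)) (V × Fin (d + 1)) ℂ :=
  shiftMat L * coinLift d ℓ * oracleMat d m

/-- The initial state `|init_lazy⟩ = (1/√(N−1)) Σ_{x ≠ m} |x⟩ ⊗ |c⟩`. -/
def initLazy (m : V) (d : ℕ) (ℓ : ℝ) : V × Fin (d + 1) → ℂ :=
  fun p => if p.1 = m then 0
    else ((1 / Real.sqrt ((Fintype.card V : ℝ) - 1) : ℝ) : ℂ) * coinVec d ℓ p.2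

/-- The state `|⇒⟩ = (1/√d)(|e_1⟩ + ⋯ + |e_d⟩)`. -/
def plusVec (d : ℕ) : Fin (d + 1) → ℂ :=
  fun a => if a = Fin.last d then 0 else ((1 / Real.sqrt d : ℝ) : ℂ)

/-- The modified oracle `Ĝ_or = I − 2(|m,↻⟩⟨m,↻| + |m,⇒⟩⟨m,⇒|)`. -/
def oracleHat (d : ℕ) (m : V) : Matrix (V × Fin (d + 1)) (V × Fin (d + 1)) ℂ :=
  1 - (2 : ℂ) • Matrix.of (fun p q =>
    (if p = (m, Fin.last d) ∧ q = (m, Fin.last d) then 1 else 0)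
    + (if p.1 = m ∧ q.1 = m then plusVec d p.2 * (starRingEnd ℂ) (plusVec d q.2) else 0))

/-- The modified lackadaisical quantum walk `Û_lazy = S · (I_N ⊗ C) · Ĝ_or`. -/
def UlazyHat {G : SimpleGraph V} {d : ℕ} (L : Labeling G d) (m : V) (ℓ : ℝ) :
    Matrix (V × Fin (d + 1)) (V × Fin (d + 1)) ℂ :=
  shiftMat L * coinLift d ℓ * oracleHat d m

/-- The action of an automorphism `σ` of `G` on arcs and self-loops:
`P_σ |x, e_i⟩ = |σ x, e_j⟩` with `y_j(σ x) = σ (y_i x)`, and `P_σ |x, ↻⟩ = |σ x, ↻⟩`. -/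
def permFun {G : SimpleGraph V} {d : ℕ} (L : Labeling G d) (σ : G ≃g G)
    (p : V × Fin (d + 1)) : V × Fin (d + 1) :=
  if h : p.2 = Fin.last d then (σ p.1, p.2)
  else
    let i : Fin d := p.2.castPred h
    ⟨σ p.1, Fin.castSucc (L.idx (σ p.1) (σ (L.nbr p.1 i)) (σ.map_adj_iff.mpr (L.adj p.1 i)))⟩

/-- The unitary `P_σ` induced by an automorphism `σ` of `G`, as a matrix. -/
def permMat {G : SimpleGraph V} {d : ℕ} (L : Labeling G d) (σ : G ≃g G) :
    Matrix (V × Fin (d + 1)) (V × Fin (d + 1)) ℂ :=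
  Matrix.of fun p q => if p = permFun L σ q then 1 else 0

/-- `G` is locally arc-transitive if for any vertex `u` with neighbors `v₁, v₂` there is an
automorphism of `G` fixing `u` and mapping `v₁` to `v₂`. -/
def LocallyArcTransitive (G : SimpleGraph V) : Prop :=
  ∀ u v₁ v₂ : V, G.Adj u v₁ → G.Adj u v₂ → ∃ σ : G ≃g G, σ u = u ∧ σ v₁ = v₂

/-- The transition matrix `P` of the simple random walk on a `d`-regular graph. -/
def Pmat (G : SimpleGraph V) [DecidableRel G.Adj] (d : ℕ) : Matrix V V ℝ :=
  Matrix.of fun x y => if G.Adj x y then (1 : ℝ) / d else 0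

/-- The absorbing walk: row `m` is replaced by the unit vector at `m`. -/
def absorb (M : Matrix V V ℝ) (m : V) : Matrix V V ℝ :=
  Matrix.of fun x y => if x = m then (if y = m then 1 else 0) else M x y

/-- The interpolated walk `M(s) = (1−s) M + s M'`. -/
def interp (M : Matrix V V ℝ) (m : V) (s : ℝ) : Matrix V V ℝ :=
  (1 - s) • M + s • absorb M m

/-- The lazy random walk `P̂ = (d/(d+ℓ)) P + (ℓ/(d+ℓ)) I`. -/
def lazyP (G : SimpleGraph V) [DecidableRel G.Adj] (d : ℕ) (ℓ : ℝ) : Matrix V V ℝ :=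
  ((d : ℝ) / (d + ℓ)) • Pmat G d + (ℓ / (d + ℓ)) • (1 : Matrix V V ℝ)

/-- The submatrix `Q` of `P` obtained by deleting the row and column of `m`. -/
def Qsub (P : Matrix V V ℝ) (m : V) :
    Matrix {x : V // x ≠ m} {x : V // x ≠ m} ℝ :=
  Matrix.of fun x y => P x.1 y.1

/-- The hitting time `HT(P, {m}) = Σ_{t≥0} (1/N) Σ_{x≠m, y≠m} (Q^t)_{xy}`. -/
def hittingTime (P : Matrix V V ℝ) (m : V) : ℝ :=
  ∑' t : ℕ, (1 / (Fintype.card V : ℝ)) *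
    ∑ x : {x : V // x ≠ m}, ∑ y : {x : V // x ≠ m}, (Qsub P m ^ t) x y

/-- The state `|x⟩ ⊗ |P(s)_x⟩ = Σ_y √(P(s)_{xy}) |x,y⟩`. -/
def psVec (Ps : Matrix V V ℝ) (x : V) : V × V → ℂ :=
  fun p => if p.1 = x then ((Real.sqrt (Ps x p.2) : ℝ) : ℂ) else 0

/-- The projection `Π_A = Σ_x |x, P(s)_x⟩⟨x, P(s)_x|` onto `span{|x⟩ ⊗ |P(s)_x⟩}`. -/
def projA (Ps : Matrix V V ℝ) : Matrix (V × V) (V × V) ℂ :=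
  Matrix.of fun p q => ∑ x, psVec Ps x p * (starRingEnd ℂ) (psVec Ps x q)

/-- The swap of the two tensor factors of `ℂ^V ⊗ ℂ^V`, as a matrix. -/
def swapMat (V : Type*) [Fintype V] [DecidableEq V] : Matrix (V × V) (V × V) ℂ :=
  Matrix.of fun p q => if p.1 = q.2 ∧ p.2 = q.1 then 1 else 0

/-- Szegedy's quantum walk `W = SWAP · (2Π_A − I)` of a walk with matrix `Ps`. -/
def Wmat (Ps : Matrix V V ℝ) : Matrix (V × V) (V × V) ℂ :=
  swapMat V * ((2 : ℂ) • projA Ps - 1)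

/-- The initial state `|init_ip⟩ = (1/√(N−1)) Σ_{x ≠ m} |x⟩ ⊗ |P(s)_x⟩`. -/
def initIp (Ps : Matrix V V ℝ) (m : V) : V × V → ℂ :=
  fun p => if p.1 = m then 0
    else ((1 / Real.sqrt ((Fintype.card V : ℝ) - 1) : ℝ) : ℂ) * ((Real.sqrt (Ps p.1 p.2) : ℝ) : ℂ)

/-- The discriminant matrix, `D_{xy} = √(M_{xy} M_{yx})`. -/
def discr (M : Matrix V V ℝ) : Matrix V V ℝ :=
  Matrix.of fun x y => Real.sqrt (M x y * M y x)

/-- The unit vector `√π̄ = (1/√(N−1)) Σ_{x ≠ m} |x⟩`. -/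
def sqrtPiBar (m : V) : V → ℝ :=
  fun x => if x = m then 0 else 1 / Real.sqrt ((Fintype.card V : ℝ) - 1)

/-- `(θ, φ)` is an orthonormal eigenbasis of the (unitary) matrix `M`, with
eigenvalues `e^{iθ_k}` and eigenvectors `φ_k`. -/
def IsONEigenbasis {ι : Type*} [Fintype ι] [DecidableEq ι] (M : Matrix ι ι ℂ)
    (θ : ι → ℝ) (φ : ι → (ι → ℂ)) : Prop :=
  (∀ k l, cip (φ k) (φ l) = if k = l then 1 else 0) ∧
  (∀ k, M.mulVec (φ k) = Complex.exp ((θ k : ℂ) * Complex.I) • φ k)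

/-- The squared cotangent quantum hitting time
`QHT(U, w)² = Σ_{e^{iθ_k} ≠ 1} |⟨φ_k|w⟩|² cot²(θ_k/2)` computed in the
orthonormal eigenbasis `(θ, φ)`. -/
def QHTsq {ι : Type*} [Fintype ι] (θ : ι → ℝ) (φ : ι → (ι → ℂ)) (w : ι → ℂ) : ℝ :=
  ∑ k, if Complex.exp ((θ k : ℂ) * Complex.I) = 1 then 0
       else Complex.normSq (cip (φ k) w) * (Real.cos (θ k / 2) / Real.sin (θ k / 2)) ^ 2

/-- `(lam, v)` is a real orthonormal eigenbasis of the symmetric matrix `M`. -/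
def IsRealONEigenbasis (M : Matrix V V ℝ) (lam : V → ℝ) (v : V → (V → ℝ)) : Prop :=
  (∀ k l, (∑ x, v k x * v l x) = if k = l then 1 else 0) ∧
  (∀ k, M.mulVec (v k) = lam k • v k)

/-- The interpolated hitting time `HT⁺ = Σ_{λ_k ≠ 1} |⟨λ_k|√π̄⟩|² / (1 − λ_k)`,
computed in the orthonormal eigenbasis `(lam, v)` of the discriminant. -/
def HTplus (lam : V → ℝ) (v : V → (V → ℝ)) (m : V) : ℝ :=
  ∑ k, if lam k = 1 then 0 else (∑ x, v k x * sqrtPiBar m x) ^ 2 / (1 - lam k)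

/-- The map `E : ℂ^V ⊗ ℂ^V → ℂ^V ⊗ ℂ^{d+1}` with `E|x, y_i(x)⟩ = |x, e_i⟩`,
`E|x,x⟩ = |x,↻⟩` for `x ≠ m`, `E|m,m⟩ = −|m,↻⟩`, and `E|x,y⟩ = 0` otherwise. -/
def Emat {G : SimpleGraph V} [DecidableRel G.Adj] {d : ℕ}
    (L : Labeling G d) (m : V) : Matrix (V × Fin (d + 1)) (V × V) ℂ :=
  Matrix.of fun p q =>
    if h : G.Adj q.1 q.2 then
      (if p = (q.1, Fin.castSucc (L.idx q.1 q.2 h)) then 1 else 0)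
    else if q.2 = q.1 then
      (if p = (q.1, Fin.last d) then (if q.1 = m then -1 else 1) else 0)
    else 0

/-- `SWAP` applied to a vector of `ℂ^V ⊗ ℂ^V`. -/
def swapVecC (v : V × V → ℂ) : V × V → ℂ := fun p => v (p.2, p.1)

/-- The unit vector `|x, Ps_x^⊥⟩` orthogonal to `|x, Ps_x⟩` in
`span{|x, Ps_x⟩, SWAP |x, Ps_x⟩}` (Gram–Schmidt phase convention). -/
def perpVec (Ps : Matrix V V ℝ) (x : V) : V × V → ℂ :=
  fun p =>
    (swapVecC (psVec Ps x) - cip (psVec Ps x) (swapVecC (psVec Ps x)) • psVec Ps x) p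
      / ((l2norm (swapVecC (psVec Ps x) - cip (psVec Ps x) (swapVecC (psVec Ps x)) • psVec Ps x) : ℝ) : ℂ)

/-- The isometry `Σ_x (|x, Ps1_x⟩⟨x, Ps2_x| + |x, Ps1_x^⊥⟩⟨x, Ps2_x^⊥|)`;
`R₁ = Rmat P̂(s) P(s)` and `R₂ = Rmat P(s) P(s)`. -/
def Rmat (Ps1 Ps2 : Matrix V V ℝ) : Matrix (V × V) (V × V) ℂ :=
  Matrix.of fun p q => ∑ x, (psVec Ps1 x p * (starRingEnd ℂ) (psVec Ps2 x q)
    + perpVec Ps1 x p * (starRingEnd ℂ) (perpVec Ps2 x q))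

end LQWPaper

namespace LQWPaper

section Helpers

variable {V : Type*} [Fintype V] [DecidableEq V]

/-- The coefficients `(α, β)` with `W^t (A v) = α • (S A v - A v) + β • A v` for the Szegedy walk `W`
and an eigenvector `v` of the discriminant with eigenvalue `l`. -/
def walkCoeff (l : ℝ) : ℕ → ℝ × ℝ
  | 0 => (0, 1)
  | t + 1 => ((2 * l - 1) * (walkCoeff l t).1 + (walkCoeff l t).2,
      (2 * l - 2) * (walkCoeff l t).1 + (walkCoeff l t).2)

lemma walkCoeff_trig {l φ : ℝ} (h : 1 - l = 2 * Real.sin φ ^ 2) (t : ℕ) :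
    2 * Real.cos φ * (Real.sin φ * (walkCoeff l t).1) = Real.sin (2 * t * φ) ∧
    Real.cos φ * (walkCoeff l t).2 = Real.cos ((2 * t - 1) * φ) := by
  have hl : l = 1 - 2 * Real.sin φ ^ 2 := by linarith
  have hcs := Real.sin_sq_add_cos_sq φ
  induction t with
  | zero => simp [walkCoeff]
  | succ t ih =>
    obtain ⟨ih1, ih2⟩ := ih
    have e1 : (2 * ((t + 1 : ℕ) : ℝ)) * φ = 2 * t * φ + 2 * φ := by push_cast; ring
    have e2 : (2 * ((t + 1 : ℕ) : ℝ) - 1) * φ = 2 * t * φ + φ := by push_cast; ring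
    have e3 : (2 * (t : ℝ) - 1) * φ = 2 * t * φ - φ := by ring
    rw [e3, Real.cos_sub] at ih2
    rw [e1, e2, Real.sin_add, Real.cos_add, Real.sin_two_mul, Real.cos_two_mul]
    simp only [walkCoeff]
    have hc2 : Real.cos φ ^ 2 = 1 - Real.sin φ ^ 2 := by linarith
    constructor
    · linear_combination (2 * l - 1) * ih1 + 2 * Real.sin φ * ih2 +
        2 * Real.sin (2 * t * φ) * hl - 2 * Real.sin (2 * t * φ) * hc2
    · linear_combination (-2 * Real.sin φ) * ih1 + ih2 + 2 * Real.cos φ * (walkCoeff l t).1 * hl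

lemma sub_le_three_mul_sin_sub {x y : ℝ} (hy : 0 ≤ y) (hyx : y ≤ x) (hx : x ≤ Real.pi / 4) :
    x - y ≤ 3 * (Real.sin x - Real.sin y) := by
  have hpi := Real.pi_pos
  have hpi' := Real.pi_lt_d2
  have h1 : 2 / Real.pi * ((x - y) / 2) ≤ Real.sin ((x - y) / 2) :=
    Real.mul_le_sin (by linarith) (by linarith)
  have h2 : Real.cos (Real.pi / 4) ≤ Real.cos ((x + y) / 2) :=
    Real.cos_le_cos_of_nonneg_of_le_pi (by linarith) (by linarith) (by linarith)
  rw [Real.cos_pi_div_four] at h2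
  have h3 : (1.4 : ℝ) ≤ √2 := Real.le_sqrt_of_sq_le (by norm_num)
  have h4 : (0.7 : ℝ) ≤ Real.cos ((x + y) / 2) := by linarith
  rw [Real.sin_sub_sin]
  have h5 : (0.3 : ℝ) * (x - y) ≤ Real.sin ((x - y) / 2) := by
    refine le_trans ?_ h1
    have : 2 / Real.pi * ((x - y) / 2) = (1 / Real.pi) * (x - y) := by ring
    rw [this]
    refine mul_le_mul_of_nonneg_right ?_ (by linarith)
    rw [le_div_iff₀ hpi]; linarith
  nlinarith [mul_le_mul h5 h4 (by norm_num) (by linarith)]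

lemma abs_div_sub_div_le {X Y c d B δ : ℝ} (hY : |Y| ≤ 1) (hc : 1 / 2 ≤ c * d) (hd0 : 0 ≤ d)
    (hd : d ≤ 1) (hXY : |X - Y| ≤ B) (hcd : |c - d| ≤ δ) (hc0 : c ≠ 0) (hd1 : d ≠ 0) :
    |X / c - Y / d| ≤ 2 * (B + δ) := by
  have hB : 0 ≤ B := (abs_nonneg _).trans hXY
  have e : X / c - Y / d = ((X - Y) * d - Y * (c - d)) / (c * d) := by field_simp; ring
  rw [e, abs_div, abs_of_pos (by linarith : 0 < c * d), div_le_iff₀ (by linarith)]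
  have h1 : |(X - Y) * d - Y * (c - d)| ≤ B * 1 + 1 * δ := by
    refine (abs_sub _ _).trans (add_le_add ?_ ?_)
    · rw [abs_mul, abs_of_nonneg hd0]; gcongr
    · rw [abs_mul]; gcongr
  have hδ : 0 ≤ δ := (abs_nonneg _).trans hcd
  nlinarith

lemma abs_sin_sub_sin_le (x y : ℝ) : |Real.sin x - Real.sin y| ≤ |x - y| := by
  rw [Real.sin_sub_sin, abs_mul, abs_mul]
  have h1 := Real.abs_sin_le_abs (x := (x - y) / 2)
  have h2 := Real.abs_cos_le_one ((x + y) / 2)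
  rw [abs_div] at h1
  simp only [abs_two] at *
  nlinarith [abs_nonneg (Real.sin ((x - y) / 2))]

lemma abs_cos_sub_cos_le (x y : ℝ) : |Real.cos x - Real.cos y| ≤ |x - y| := by
  rw [← Real.sin_add_pi_div_two, ← Real.sin_add_pi_div_two]
  simpa using abs_sin_sub_sin_le (x + Real.pi / 2) (y + Real.pi / 2)

lemma walkCoeff_bounds {l l' r : ℝ} (hl0 : 0 ≤ l) (hl1 : l ≤ 1) (hr0 : 0 ≤ r) (hr1 : r ≤ 1)
    (h : 1 - l' = r ^ 2 * (1 - l)) (t : ℕ) :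
    (1 - l) * ((walkCoeff l t).1 - r * (walkCoeff l' t).1) ^ 2 ≤
        (12 * (t + 1) * (1 - r)) ^ 2 * (1 - l) ∧
      (walkCoeff l t).2 ^ 2 ≤ 2 ∧
      ((walkCoeff l t).2 - (walkCoeff l' t).2) ^ 2 ≤ (12 * (t + 1) * (1 - r)) ^ 2 * (1 - l) := by
  have hpi := Real.pi_pos
  set s := √((1 - l) / 2) with hs
  have hs0 : 0 ≤ s := Real.sqrt_nonneg _
  have hs2 : s ^ 2 = (1 - l) / 2 := Real.sq_sqrt (by linarith)
  have hs1 : s ≤ √2 / 2 := by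
    rw [hs, Real.sqrt_le_iff]
    refine ⟨by positivity, ?_⟩
    rw [div_pow, Real.sq_sqrt (by norm_num)]; linarith
  have hq : √2 / 2 ≤ 1 := by
    have : √2 ≤ 2 := Real.sqrt_le_iff.2 ⟨by norm_num, by norm_num⟩
    linarith
  have hrs : r * s ≤ s := mul_le_of_le_one_left hs0 hr1
  have hrs0 : 0 ≤ r * s := mul_nonneg hr0 hs0
  set φ := Real.arcsin s with hφ
  set ψ := Real.arcsin (r * s) with hψ
  have sφ : Real.sin φ = s := Real.sin_arcsin (by linarith) (by linarith)
  have sψ : Real.sin ψ = r * s := Real.sin_arcsin (by linarith) (by linarith)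
  have hψ0 : 0 ≤ ψ := Real.arcsin_nonneg.2 hrs0
  have hψφ : ψ ≤ φ := Real.arcsin_le_arcsin hrs
  have hφ4 : φ ≤ Real.pi / 4 := by
    rw [hφ, Real.arcsin_le_iff_le_sin ⟨by linarith, by linarith⟩ ⟨by linarith, by linarith⟩,
      Real.sin_pi_div_four]
    exact hs1
  have hδ := sub_le_three_mul_sin_sub hψ0 hψφ hφ4
  rw [sφ, sψ] at hδ
  have hcφ : √2 / 2 ≤ Real.cos φ := by
    rw [← Real.cos_pi_div_four]
    exact Real.cos_le_cos_of_nonneg_of_le_pi (by linarith) (by linarith) hφ4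
  have hcψ : √2 / 2 ≤ Real.cos ψ := by
    rw [← Real.cos_pi_div_four]
    exact Real.cos_le_cos_of_nonneg_of_le_pi (by linarith) (by linarith) (by linarith)
  have h2 : 0 < √2 / 2 := by positivity
  have hc0 : 0 < Real.cos φ := by linarith
  have hd0 : 0 < Real.cos ψ := by linarith
  have e : √2 / 2 * (√2 / 2) = 1 / 2 := by
    rw [div_mul_div_comm, Real.mul_self_sqrt (by norm_num)]; norm_num
  have hcc : (1 : ℝ) / 2 ≤ Real.cos φ * Real.cos ψ := by
    have := mul_le_mul hcφ hcψ h2.le hc0.le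
    linarith
  obtain ⟨a1, b1⟩ := walkCoeff_trig (l := l) (φ := φ) (by rw [sφ]; linarith) t
  obtain ⟨a2, b2⟩ := walkCoeff_trig (l := l') (φ := ψ) (by rw [sψ, mul_pow, hs2, h]; ring) t
  rw [sφ] at a1
  rw [sψ] at a2
  have hcd : |Real.cos φ - Real.cos ψ| ≤ φ - ψ := by
    simpa [abs_of_nonneg (sub_nonneg.2 hψφ)] using abs_cos_sub_cos_le φ ψ
  have ht : (0 : ℝ) ≤ t := Nat.cast_nonneg t
  have hκ : 4 * (t + 1) * (φ - ψ) ≤ 12 * (t + 1) * (1 - r) * s := by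
    have := mul_le_mul_of_nonneg_left hδ (show (0 : ℝ) ≤ 4 * (t + 1) by positivity)
    linarith
  have hp : 0 ≤ φ - ψ := sub_nonneg.2 hψφ
  have k1 : |Real.sin (2 * t * φ) / Real.cos φ - Real.sin (2 * t * ψ) / Real.cos ψ| ≤
      12 * (t + 1) * (1 - r) * s := by
    refine (abs_div_sub_div_le (B := 2 * t * (φ - ψ)) (Real.abs_sin_le_one _) hcc hd0.le
      (Real.cos_le_one _) ?_ hcd hc0.ne' hd0.ne').trans ?_
    · refine (abs_sin_sub_sin_le _ _).trans ?_
      rw [← mul_sub, abs_of_nonneg (by positivity)]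
    · nlinarith
  have k2 : |Real.cos ((2 * t - 1) * φ) / Real.cos φ - Real.cos ((2 * t - 1) * ψ) / Real.cos ψ| ≤
      12 * (t + 1) * (1 - r) * s := by
    refine (abs_div_sub_div_le (B := (2 * t + 1) * (φ - ψ)) (Real.abs_cos_le_one _) hcc hd0.le
      (Real.cos_le_one _) ?_ hcd hc0.ne' hd0.ne').trans ?_
    · refine (abs_cos_sub_cos_le _ _).trans ?_
      rw [← mul_sub, abs_mul, abs_of_nonneg hp]
      gcongr
      rw [abs_le]; constructor <;> linarith
    · nlinarith
  have f1 : s * ((walkCoeff l t).1 - r * (walkCoeff l' t).1) =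
      (Real.sin (2 * t * φ) / Real.cos φ - Real.sin (2 * t * ψ) / Real.cos ψ) / 2 := by
    rw [← a1, ← a2]; field_simp
  have f2 : (walkCoeff l t).2 - (walkCoeff l' t).2 =
      Real.cos ((2 * t - 1) * φ) / Real.cos φ - Real.cos ((2 * t - 1) * ψ) / Real.cos ψ := by
    rw [← b1, ← b2]; field_simp
  have g1 := sq_le_sq' (neg_le_of_abs_le k1) (le_of_abs_le k1)
  have g2 := sq_le_sq' (neg_le_of_abs_le k2) (le_of_abs_le k2)
  rw [mul_pow, hs2] at g1 g2
  have hnn : 0 ≤ (12 * (t + 1) * (1 - r)) ^ 2 * (1 - l) :=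
    mul_nonneg (sq_nonneg _) (by linarith)
  refine ⟨?_, ?_, ?_⟩
  · have : (1 - l) * ((walkCoeff l t).1 - r * (walkCoeff l' t).1) ^ 2 =
        2 * (s * ((walkCoeff l t).1 - r * (walkCoeff l' t).1)) ^ 2 := by
      rw [mul_pow, hs2]; ring
    rw [this, f1, div_pow]
    linarith
  · have e : (walkCoeff l t).2 = Real.cos ((2 * t - 1) * φ) / Real.cos φ := by
      rw [← b1]; field_simp
    rw [e, div_pow, div_le_iff₀ (by positivity)]
    have hc2 : (1 : ℝ) / 2 ≤ Real.cos φ ^ 2 := by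
      have := mul_le_mul hcφ hcφ h2.le hc0.le
      rw [sq]; linarith
    linarith [Real.cos_sq_le_one ((2 * t - 1) * φ)]
  · rw [f2]
    linarith

section AbstractWalk

variable {H K : Type*} [NormedAddCommGroup H] [InnerProductSpace ℂ H]
  [NormedAddCommGroup K] [InnerProductSpace ℂ K]

lemma walk_pow_apply_eigenvector {A : H →ₗ[ℂ] K} {S W : K →ₗ[ℂ] K} {D : H →ₗ[ℂ] H}
    (hWA : ∀ x, W (A x) = S (A x)) (hWS : ∀ x, W (S (A x)) = (2 : ℂ) • S (A (D x)) - A x)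
    {v : H} {l : ℝ} (hv : D v = (l : ℂ) • v) (t : ℕ) :
    (W ^ t) (A v) = ((walkCoeff l t).1 : ℂ) • (S (A v) - A v) + ((walkCoeff l t).2 : ℂ) • A v := by
  induction t with
  | zero => simp [walkCoeff]
  | succ t ih =>
    rw [pow_succ', Module.End.mul_apply, ih]
    simp only [map_add, map_smul, map_sub, hWA, hWS, hv, walkCoeff]
    push_cast
    module

lemma norm_pow_apply {W : K →ₗ[ℂ] K} (hW : ∀ y, ‖W y‖ = ‖y‖) (t : ℕ) (y : K) :
    ‖(W ^ t) y‖ = ‖y‖ := by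
  induction t with
  | zero => simp
  | succ t ih => rw [pow_succ', Module.End.mul_apply, hW, ih]

lemma norm_sub_self_sq {A : H →ₗ[ℂ] K} {S : K →ₗ[ℂ] K} {D : H →ₗ[ℂ] H}
    (hA : ∀ x, ‖A x‖ = ‖x‖) (hS : ∀ y, ‖S y‖ = ‖y‖)
    (hD : ∀ x y, inner ℂ (A x) (S (A y)) = inner ℂ x (D y)) (z : H) :
    ‖S (A z) - A z‖ ^ 2 = 2 * (inner ℂ z (z - D z)).re := by
  rw [@norm_sub_sq ℂ, inner_re_symm, hD, hS, hA, inner_sub_right]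
  have h : (inner ℂ z z).re = ‖z‖ ^ 2 := inner_self_eq_norm_sq (𝕜 := ℂ) z
  rw [Complex.sub_re, h, RCLike.re_to_complex]
  ring

lemma norm_sq_sum_smul {n : ℕ} (b : OrthonormalBasis (Fin n) ℂ H) (F : Finset (Fin n))
    (k : Fin n → ℂ) : ‖∑ i ∈ F, k i • b i‖ ^ 2 = ∑ i ∈ F, ‖k i‖ ^ 2 := by
  rw [← @inner_self_eq_norm_sq ℂ, b.orthonormal.inner_sum]
  simp only [map_sum]
  refine Finset.sum_congr rfl fun i _ => ?_
  rw [← RCLike.normSq_eq_def', RCLike.normSq_apply]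
  simp

lemma norm_sub_self_sq_sum {A : H →ₗ[ℂ] K} {S : K →ₗ[ℂ] K} {D : H →ₗ[ℂ] H}
    (hA : ∀ x, ‖A x‖ = ‖x‖) (hS : ∀ y, ‖S y‖ = ‖y‖)
    (hD : ∀ x y, inner ℂ (A x) (S (A y)) = inner ℂ x (D y)) {n : ℕ}
    (b : OrthonormalBasis (Fin n) ℂ H) {l : Fin n → ℝ} (hb : ∀ i, D (b i) = (l i : ℂ) • b i)
    (F : Finset (Fin n)) (k : Fin n → ℂ) :
    ‖S (A (∑ i ∈ F, k i • b i)) - A (∑ i ∈ F, k i • b i)‖ ^ 2 =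
      2 * ∑ i ∈ F, (1 - l i) * ‖k i‖ ^ 2 := by
  rw [norm_sub_self_sq hA hS hD]
  congr 1
  have e : (∑ i ∈ F, k i • b i) - D (∑ i ∈ F, k i • b i) =
      ∑ i ∈ F, (k i * (1 - l i : ℝ)) • b i := by
    rw [map_sum, ← Finset.sum_sub_distrib]
    refine Finset.sum_congr rfl fun i _ => ?_
    rw [map_smul, hb]
    push_cast
    module
  rw [e, b.orthonormal.inner_sum, Complex.re_sum]
  refine Finset.sum_congr rfl fun i _ => ?_
  rw [← mul_assoc, Complex.re_mul_ofReal, mul_comm, ← Complex.normSq_eq_conj_mul_self,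
    Complex.ofReal_re, Complex.normSq_eq_norm_sq]

theorem norm_walk_sub_walk_le [FiniteDimensional ℂ H] {A A' : H →ₗ[ℂ] K} {S W W' : K →ₗ[ℂ] K}
    {D D' : H →ₗ[ℂ] H} {r η γ : ℝ} (hr0 : 0 ≤ r) (hr1 : r ≤ 1) (hη : 0 ≤ η)
    (hA : ∀ x, ‖A x‖ = ‖x‖) (hA' : ∀ x, ‖A' x‖ = ‖x‖) (hS : ∀ y, ‖S y‖ = ‖y‖)
    (hDsymm : D.IsSymmetric)
    (hD : ∀ x y, inner ℂ (A x) (S (A y)) = inner ℂ x (D y))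
    (hDD' : ∀ x, x - D' x = ((r ^ 2 : ℝ) : ℂ) • (x - D x))
    (hWA : ∀ x, W (A x) = S (A x)) (hWS : ∀ x, W (S (A x)) = (2 : ℂ) • S (A (D x)) - A x)
    (hWA' : ∀ x, W' (A' x) = S (A' x))
    (hWS' : ∀ x, W' (S (A' x)) = (2 : ℂ) • S (A' (D' x)) - A' x)
    (hW : ∀ y, ‖W y‖ = ‖y‖) (hW' : ∀ y, ‖W' y‖ = ‖y‖)
    (hAA' : ∀ x, S (A' x) - A' x = (r : ℂ) • (S (A x) - A x))
    (hclose : ∀ x, ‖A x - A' x‖ ≤ η * ‖x‖)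
    {v : H} (hv1 : ‖v‖ = 1) (hv : (inner ℂ v (v - D v)).re ≤ γ) (t : ℕ) :
    ‖(W ^ t) (A v) - (W' ^ t) (A' v)‖ ≤
      (2 + 36 * (t + 1) * (1 - r)) * √γ + 2 * η := by
  obtain ⟨n, b, l, hb⟩ : ∃ (n : ℕ) (b : OrthonormalBasis (Fin n) ℂ H) (l : Fin n → ℝ),
      ∀ i, D (b i) = (l i : ℂ) • b i :=
    ⟨_, hDsymm.eigenvectorBasis rfl, hDsymm.eigenvalues rfl, hDsymm.apply_eigenvectorBasis rfl⟩
  set l' : Fin n → ℝ := fun i => 1 - r ^ 2 * (1 - l i) with hl'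
  have hb' : ∀ i, D' (b i) = (l' i : ℂ) • b i := by
    intro i
    have h := hDD' (b i)
    rw [hb, sub_eq_iff_eq_add, ← sub_eq_iff_eq_add'] at h
    rw [← h, hl']
    push_cast
    module
  have hl1 : ∀ i, l i ≤ 1 := by
    intro i
    have h := norm_sub_self_sq_sum hA hS hD b hb {i} (fun _ => 1)
    simp only [Finset.sum_singleton, norm_one] at h
    nlinarith [sq_nonneg ‖S (A ((1 : ℂ) • b i)) - A ((1 : ℂ) • b i)‖]
  set a : Fin n → ℂ := fun i => inner ℂ (b i) v with ha
  have hva : v = ∑ i, a i • b i := (b.sum_repr' v).symm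
  have hsum1 : ∑ i, ‖a i‖ ^ 2 = 1 := by
    rw [← norm_sq_sum_smul b, ← hva, hv1, one_pow]
  have hsumγ : ∑ i, (1 - l i) * ‖a i‖ ^ 2 ≤ γ := by
    have h1 := norm_sub_self_sq_sum hA hS hD b hb Finset.univ a
    rw [← hva, norm_sub_self_sq hA hS hD] at h1
    linarith
  have hterm : ∀ i, 0 ≤ (1 - l i) * ‖a i‖ ^ 2 := fun i =>
    mul_nonneg (sub_nonneg.2 (hl1 i)) (sq_nonneg _)
  have hγ : 0 ≤ γ := (Finset.sum_nonneg fun i _ => hterm i).trans hsumγ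
  have hnorm : ∀ (x : ℝ) (w : ℂ), ‖(x : ℂ) * w‖ ^ 2 = x ^ 2 * ‖w‖ ^ 2 := by
    intro x w
    rw [norm_mul, Complex.norm_real, mul_pow, Real.norm_eq_abs, sq_abs]
  set F := Finset.univ.filter fun i => 0 ≤ l i with hF
  set G := Finset.univ.filter fun i => ¬ 0 ≤ l i with hG
  have hFγ : ∑ i ∈ F, (1 - l i) * ‖a i‖ ^ 2 ≤ γ :=
    (Finset.sum_le_sum_of_subset_of_nonneg (Finset.subset_univ _) fun i _ _ => hterm i).trans hsumγ
  set vl := ∑ i ∈ F, a i • b i with hvl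
  set vh := ∑ i ∈ G, a i • b i with hvh
  have hsplit : v = vl + vh := by
    rw [hva, hvl, hvh, hF, hG, Finset.sum_filter_add_sum_filter_not]
  have hvhn : ‖vh‖ ≤ √γ := by
    refine Real.le_sqrt_of_sq_le ?_
    rw [hvh, norm_sq_sum_smul]
    refine le_trans ?_ ((Finset.sum_le_sum_of_subset_of_nonneg (Finset.subset_univ G)
      fun i _ _ => hterm i).trans hsumγ)
    refine Finset.sum_le_sum fun i hi => ?_
    have : l i < 0 := by simpa [hG] using hi
    nlinarith [sq_nonneg ‖a i‖]
  set κ := 12 * (t + 1) * (1 - r) with hκ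
  have hκ0 : 0 ≤ κ := by have := sub_nonneg.2 hr1; positivity
  have hc := fun i (hi : i ∈ F) => walkCoeff_bounds (l := l i) (l' := l' i) (r := r)
    (by simpa [hF] using hi) (hl1 i) hr0 hr1 (by simp only [hl']; ring) t
  set z := ∑ i ∈ F,
    ((((walkCoeff (l i) t).1 - r * (walkCoeff (l' i) t).1 : ℝ) : ℂ) * a i) • b i with hz
  set g := ∑ i ∈ F, (((walkCoeff (l i) t).2 : ℂ) * a i) • b i with hg
  set e := ∑ i ∈ F,
    ((((walkCoeff (l i) t).2 - (walkCoeff (l' i) t).2 : ℝ) : ℂ) * a i) • b i with he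
  have hlow : (W ^ t) (A vl) - (W' ^ t) (A' vl) = (S (A z) - A z) + (A g - A' g) + A' e := by
    simp only [hvl, hz, hg, he, map_sum, map_smul, ← Finset.sum_sub_distrib,
      ← Finset.sum_add_distrib]
    refine Finset.sum_congr rfl fun i _ => ?_
    rw [walk_pow_apply_eigenvector hWA hWS (hb i), walk_pow_apply_eigenvector hWA' hWS' (hb' i),
      hAA']
    push_cast
    module
  have hzn : ‖S (A z) - A z‖ ≤ 2 * κ * √γ := by
    refine le_of_sq_le_sq ?_ (by positivity)
    rw [norm_sub_self_sq_sum hA hS hD b hb, mul_pow, mul_pow, Real.sq_sqrt hγ]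
    have h : ∑ i ∈ F, (1 - l i) * ‖(((walkCoeff (l i) t).1 - r * (walkCoeff (l' i) t).1 : ℝ) : ℂ) *
        a i‖ ^ 2 ≤ ∑ i ∈ F, κ ^ 2 * ((1 - l i) * ‖a i‖ ^ 2) := by
      refine Finset.sum_le_sum fun i hi => ?_
      rw [hnorm]
      nlinarith [mul_le_mul_of_nonneg_right (hc i hi).1 (sq_nonneg ‖a i‖)]
    rw [← Finset.mul_sum] at h
    nlinarith [mul_le_mul_of_nonneg_left hFγ (sq_nonneg κ), mul_nonneg (sq_nonneg κ) hγ]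
  have hgn : ‖g‖ ≤ 2 := by
    refine le_of_sq_le_sq ?_ (by positivity)
    rw [hg, norm_sq_sum_smul]
    have h : ∑ i ∈ F, ‖((walkCoeff (l i) t).2 : ℂ) * a i‖ ^ 2 ≤ ∑ i ∈ F, 2 * ‖a i‖ ^ 2 := by
      refine Finset.sum_le_sum fun i hi => ?_
      rw [hnorm]
      exact mul_le_mul_of_nonneg_right (hc i hi).2.1 (sq_nonneg _)
    rw [← Finset.mul_sum] at h
    have h2 := Finset.sum_le_sum_of_subset_of_nonneg (Finset.subset_univ F)
      fun i _ _ => sq_nonneg ‖a i‖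
    linarith
  have hen : ‖e‖ ≤ κ * √γ := by
    refine le_of_sq_le_sq ?_ (by positivity)
    rw [he, norm_sq_sum_smul, mul_pow, Real.sq_sqrt hγ]
    have h : ∑ i ∈ F, ‖(((walkCoeff (l i) t).2 - (walkCoeff (l' i) t).2 : ℝ) : ℂ) * a i‖ ^ 2 ≤
        ∑ i ∈ F, κ ^ 2 * ((1 - l i) * ‖a i‖ ^ 2) := by
      refine Finset.sum_le_sum fun i hi => ?_
      rw [hnorm, ← mul_assoc]
      exact mul_le_mul_of_nonneg_right (hc i hi).2.2 (sq_nonneg _)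
    rw [← Finset.mul_sum] at h
    exact h.trans (mul_le_mul_of_nonneg_left hFγ (sq_nonneg κ))
  have hlown : ‖(W ^ t) (A vl) - (W' ^ t) (A' vl)‖ ≤ 2 * κ * √γ + η * 2 + κ * √γ := by
    rw [hlow]
    refine (norm_add₃_le).trans (add_le_add (add_le_add hzn ?_) ?_)
    · exact (hclose g).trans (by gcongr)
    · rwa [hA']
  have hhigh : ‖(W ^ t) (A vh) - (W' ^ t) (A' vh)‖ ≤ √γ + √γ := by
    refine (norm_sub_le _ _).trans (add_le_add ?_ ?_)
    · rwa [norm_pow_apply hW, hA]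
    · rwa [norm_pow_apply hW', hA']
  have hdec : (W ^ t) (A v) - (W' ^ t) (A' v) =
      ((W ^ t) (A vl) - (W' ^ t) (A' vl)) + ((W ^ t) (A vh) - (W' ^ t) (A' vh)) := by
    rw [hsplit]; simp only [map_add]; abel
  rw [hdec]
  refine (norm_add_le _ _).trans ((add_le_add hlown hhigh).trans (le_of_eq ?_))
  rw [hκ]; ring

end AbstractWalk

section HittingTime

variable {G : SimpleGraph V} [DecidableRel G.Adj] {d : ℕ}

lemma exists_geodesic (hG : G.Connected) (m x : V) :
    ∃ f : ℕ → V, f 0 = m ∧ f (G.dist m x) = x ∧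
      (∀ i < G.dist m x, G.Adj (f i) (f (i + 1))) ∧ ∀ i ≤ G.dist m x, G.dist m (f i) = i := by
  obtain ⟨p, hp⟩ := hG.exists_walk_length_eq_dist m x
  refine ⟨p.getVert, p.getVert_zero, by rw [← hp]; exact p.getVert_length, fun i hi =>
    p.adj_getVert_succ (hp ▸ hi), fun i hi => le_antisymm ?_ ?_⟩
  · refine (SimpleGraph.dist_le (p.take i)).trans ?_
    simp
  · have h1 := SimpleGraph.dist_le (p.drop i)
    have h2 := hG.dist_triangle (u := m) (v := p.getVert i) (w := x)
    rw [SimpleGraph.Walk.drop_length] at h1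
    omega

lemma dist_mul_degree_le (hG : G.Connected) (hreg : G.IsRegularOfDegree d) (m x : V) :
    G.dist m x * d ≤ 3 * Fintype.card V := by
  obtain ⟨f, -, -, -, hf⟩ := exists_geodesic hG m x
  have h1 : G.dist m x * d =
      ∑ i ∈ Finset.range (G.dist m x), ∑ y, if G.Adj (f i) y then 1 else 0 := by
    rw [Finset.sum_congr rfl fun i _ => show _ = d by
      rw [← Finset.card_filter, ← hreg (f i), ← G.card_neighborFinset_eq_degree]
      congr 1; ext; simp]
    simp
  rw [h1, Finset.sum_comm, mul_comm, ← smul_eq_mul, ← Finset.card_univ]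
  refine Finset.sum_le_card_nsmul _ _ _ fun y _ => ?_
  rw [← Finset.card_filter]
  refine (Finset.card_le_card (t := Finset.Icc (G.dist m y - 1) (G.dist m y + 1))
    fun i hi => ?_).trans ?_
  · simp only [Finset.mem_filter, Finset.mem_range] at hi
    have h2 := hf i hi.1.le
    have h3 := SimpleGraph.dist_eq_one_iff_adj.2 hi.2
    have h4 := hG.dist_triangle (u := m) (v := f i) (w := y)
    have h5 := hG.dist_triangle (u := m) (v := y) (w := f i)
    rw [SimpleGraph.dist_comm (u := y)] at h5
    rw [Finset.mem_Icc]
    omega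
  · rw [Nat.card_Icc]; omega

lemma sq_le_dist_mul_sum (hG : G.Connected) {m : V} {h : V → ℝ} (hm : h m = 0) (x : V) :
    h x ^ 2 ≤ G.dist m x * ∑ y, ∑ z, if G.Adj y z then (h y - h z) ^ 2 else 0 := by
  obtain ⟨f, hf0, hfL, hadj, hf⟩ := exists_geodesic hG m x
  have h1 : h x = ∑ i ∈ Finset.range (G.dist m x), (h (f (i + 1)) - h (f i)) := by
    rw [Finset.sum_range_sub (fun i => h (f i)), hf0, hfL, hm, sub_zero]
  rw [h1]
  refine sq_sum_le_card_mul_sum_sq.trans ?_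
  rw [Finset.card_range]
  refine mul_le_mul_of_nonneg_left ?_ (Nat.cast_nonneg _)
  rw [← Fintype.sum_prod_type' (fun y z => if G.Adj y z then (h y - h z) ^ 2 else 0)]
  have hinj : Set.InjOn (fun i => (f i, f (i + 1))) (Finset.range (G.dist m x)) := by
    intro i hi j hj hij
    simp only [Finset.coe_range, Set.mem_Iio] at hi hj
    rw [← hf i hi.le, ← hf j hj.le, (Prod.mk.inj hij).1]
  rw [Finset.sum_congr rfl fun i hi => show (h (f (i + 1)) - h (f i)) ^ 2 =
    (fun p : V × V => if G.Adj p.1 p.2 then (h p.1 - h p.2) ^ 2 else 0) (f i, f (i + 1)) by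
      simp only [hadj i (Finset.mem_range.1 hi), if_true]; ring]
  rw [← Finset.sum_image (g := fun i => (f i, f (i + 1)))
    (f := fun p : V × V => if G.Adj p.1 p.2 then (h p.1 - h p.2) ^ 2 else 0) hinj]
  refine Finset.sum_le_sum_of_subset_of_nonneg (Finset.subset_univ _) fun p _ _ => ?_
  split_ifs <;> positivity

lemma Pmat_nonneg (x y : V) : 0 ≤ Pmat G d x y := by
  simp only [Pmat, Matrix.of_apply]; split_ifs <;> positivity

lemma Pmat_comm (x y : V) : Pmat G d x y = Pmat G d y x := by
  simp only [Pmat, Matrix.of_apply, G.adj_comm]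

lemma Pmat_sum (hd : 1 ≤ d) (hreg : G.IsRegularOfDegree d) (x : V) : ∑ y, Pmat G d x y = 1 := by
  have hd' : (d : ℝ) ≠ 0 := by positivity
  simp only [Pmat, Matrix.of_apply]
  rw [← Finset.sum_filter, Finset.sum_const, nsmul_eq_mul, ← hreg x,
    ← G.card_neighborFinset_eq_degree,
    show Finset.univ.filter (fun y => G.Adj x y) = G.neighborFinset x by ext; simp]
  rw [G.card_neighborFinset_eq_degree, hreg x]
  field_simp

lemma sum_Pmat_mul_sq (hd : 1 ≤ d) (hreg : G.IsRegularOfDegree d) (h : V → ℝ) :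
    ∑ x, ∑ y, Pmat G d x y * (h x - h y) ^ 2 =
      2 * ∑ x, h x * (h x - ∑ y, Pmat G d x y * h y) := by
  have e1 : ∑ x, ∑ y, Pmat G d x y * h x ^ 2 = ∑ x, h x ^ 2 := by
    refine Finset.sum_congr rfl fun x _ => ?_
    rw [← Finset.sum_mul, Pmat_sum hd hreg, one_mul]
  have e2 : ∑ x, ∑ y, Pmat G d x y * h y ^ 2 = ∑ x, h x ^ 2 := by
    rw [Finset.sum_comm, ← e1]
    refine Finset.sum_congr rfl fun x _ => Finset.sum_congr rfl fun y _ => ?_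
    rw [Pmat_comm]
  calc _ = ∑ x, ∑ y, Pmat G d x y * h x ^ 2 + ∑ x, ∑ y, Pmat G d x y * h y ^ 2 -
        2 * ∑ x, ∑ y, h x * (Pmat G d x y * h y) := by
        simp only [Finset.mul_sum, ← Finset.sum_add_distrib, ← Finset.sum_sub_distrib]
        refine Finset.sum_congr rfl fun x _ => Finset.sum_congr rfl fun y _ => ?_
        ring
    _ = _ := by
        rw [e1, e2]
        simp only [mul_sub, Finset.sum_sub_distrib, ← Finset.mul_sum, ← sq]
        ring

/-- A nonnegative function vanishing at the marked vertex whose Laplacian is at most `1`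
elsewhere has total mass at most `6 N ^ 3`. -/
lemma sum_le_of_laplacian_le_one (hG : G.Connected) (hd : 1 ≤ d) (hreg : G.IsRegularOfDegree d)
    {m : V} {h : V → ℝ} (hm : h m = 0) (h0 : ∀ x, 0 ≤ h x)
    (h1 : ∀ x, x ≠ m → h x - ∑ y, Pmat G d x y * h y ≤ 1) :
    ∑ x, h x ≤ 6 * (Fintype.card V : ℝ) ^ 3 := by
  set N : ℝ := (Fintype.card V : ℝ) with hN
  have hN0 : 0 ≤ N := Nat.cast_nonneg _
  set T := ∑ x, h x with hT
  have hT0 : 0 ≤ T := Finset.sum_nonneg fun x _ => h0 x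
  set R := ∑ y, ∑ z, if G.Adj y z then (h y - h z) ^ 2 else 0 with hR
  have hR0 : 0 ≤ R := Finset.sum_nonneg fun y _ => Finset.sum_nonneg fun z _ => by
    split_ifs <;> positivity
  have hd' : (0 : ℝ) < d := by positivity
  have hRT : R ≤ d * (2 * T) := by
    have e : R = d * ∑ x, ∑ y, Pmat G d x y * (h x - h y) ^ 2 := by
      simp only [hR, Finset.mul_sum, Pmat, Matrix.of_apply]
      refine Finset.sum_congr rfl fun x _ => Finset.sum_congr rfl fun y _ => ?_
      split_ifs
      · field_simp
      · simp
    rw [e, sum_Pmat_mul_sq hd hreg]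
    refine mul_le_mul_of_nonneg_left (mul_le_mul_of_nonneg_left
      (Finset.sum_le_sum fun x _ => ?_) two_pos.le) hd'.le
    by_cases hx : x = m
    · simp [hx, hm]
    · exact mul_le_of_le_one_right (h0 x) (h1 x hx)
  have hx : ∀ x, h x ^ 2 ≤ 6 * N * T := fun x => by
    have hD : (G.dist m x : ℝ) * d ≤ 3 * N := by
      rw [hN]; exact_mod_cast dist_mul_degree_le hG hreg m x
    calc h x ^ 2 ≤ G.dist m x * R := sq_le_dist_mul_sum hG hm x
      _ ≤ G.dist m x * (d * (2 * T)) := by gcongr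
      _ = (G.dist m x * d) * (2 * T) := by ring
      _ ≤ 3 * N * (2 * T) := by gcongr
      _ = _ := by ring
  have hTT : T ^ 2 ≤ N * (N * (6 * N * T)) := by
    refine sq_sum_le_card_mul_sum_sq.trans ?_
    rw [Finset.card_univ]
    refine mul_le_mul_of_nonneg_left ?_ hN0
    refine (Finset.sum_le_card_nsmul _ _ _ fun x _ => hx x).trans (le_of_eq ?_)
    rw [Finset.card_univ, nsmul_eq_mul]
  rcases hT0.eq_or_lt with h | h
  · rw [← h]; positivity
  · nlinarith

theorem hittingTime_Pmat_le (hG : G.Connected) (hd : 1 ≤ d) (hreg : G.IsRegularOfDegree d)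
    (m : V) : hittingTime (Pmat G d) m ≤ 6 * (Fintype.card V : ℝ) ^ 2 := by
  set Q := Qsub (Pmat G d) m with hQ
  have hQ0 : ∀ t x y, 0 ≤ (Q ^ t) x y := by
    intro t
    induction t with
    | zero => intro x y; rw [pow_zero, Matrix.one_apply]; split_ifs <;> norm_num
    | succ t ih =>
      intro x y
      rw [pow_succ', Matrix.mul_apply]
      exact Finset.sum_nonneg fun z _ => mul_nonneg (Pmat_nonneg _ _) (ih z y)
  set q : ℕ → {x : V // x ≠ m} → ℝ := fun t x => ∑ y, (Q ^ t) x y with hq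
  have hq0 : ∀ t x, 0 ≤ q t x := fun t x => Finset.sum_nonneg fun y _ => hQ0 t x y
  have hqs : ∀ t x, q (t + 1) x = ∑ z, Q x z * q t z := by
    intro t x
    simp only [hq, pow_succ', Matrix.mul_apply, Finset.mul_sum]
    exact Finset.sum_comm
  have hN : (0 : ℝ) < Fintype.card V := by
    have : Nonempty V := ⟨m⟩
    exact_mod_cast Fintype.card_pos
  rw [hittingTime]
  refine Real.tsum_le_of_sum_range_le (fun t => ?_) fun n => ?_
  · exact mul_nonneg (by positivity) (Finset.sum_nonneg fun x _ => hq0 t x)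
  rw [← Finset.mul_sum, one_div, inv_mul_le_iff₀ hN, Finset.sum_comm]
  set h : V → ℝ := fun x => if hx : x ≠ m then ∑ t ∈ Finset.range n, q t ⟨x, hx⟩ else 0 with hh
  have hhs : ∀ x : {x : V // x ≠ m}, h x = ∑ t ∈ Finset.range n, q t x := by
    rintro ⟨x, hx⟩; simp [hh, hx]
  have hhm : h m = 0 := by simp [hh]
  have hsum : ∀ k : V → ℝ, k m = 0 → ∑ x, k x = ∑ x : {x : V // x ≠ m}, k x := by
    intro k hk
    rw [Fintype.sum_eq_add_sum_subtype_ne k m, hk, zero_add]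
  have key := sum_le_of_laplacian_le_one hG hd hreg hhm (fun x => by
    simp only [hh]; split_ifs
    · exact Finset.sum_nonneg fun t _ => hq0 t _
    · exact le_rfl) (fun x hx => by
    rw [hsum _ (by rw [hhm, mul_zero])]
    have e1 : ∑ y : {x : V // x ≠ m}, Pmat G d x y * h y =
        ∑ t ∈ Finset.range n, q (t + 1) ⟨x, hx⟩ := by
      simp only [hhs, hqs, Finset.mul_sum]
      exact Finset.sum_comm
    rw [e1, hhs ⟨x, hx⟩, ← Finset.sum_sub_distrib, Finset.sum_range_sub' (fun t => q t ⟨x, hx⟩)]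
    have e2 : q 0 ⟨x, hx⟩ = 1 := by simp [hq, Matrix.one_apply]
    rw [e2]
    linarith [hq0 n ⟨x, hx⟩])
  rw [hsum h hhm] at key
  simp only [hhs] at key
  refine key.trans (le_of_eq (by ring))

end HittingTime

section Szegedy

lemma toEuclideanLin_apply_apply {ι κ μ : Type*} [Fintype κ] [DecidableEq κ] [Fintype μ]
    [DecidableEq μ] (X : Matrix ι κ ℂ) (Y : Matrix κ μ ℂ) (x : EuclideanSpace ℂ μ) :
    Matrix.toEuclideanLin X (Matrix.toEuclideanLin Y x) = Matrix.toEuclideanLin (X * Y) x := by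
  rw [Matrix.toLpLin_mul_same, LinearMap.comp_apply]

lemma norm_toEuclideanLin_apply {ι κ : Type*} [Fintype ι] [DecidableEq ι] [Fintype κ]
    [DecidableEq κ] {U : Matrix κ ι ℂ} (hU : U.conjTranspose * U = 1) (x : EuclideanSpace ℂ ι) :
    ‖Matrix.toEuclideanLin U x‖ = ‖x‖ := by
  have h : inner ℂ (Matrix.toEuclideanLin U x) (Matrix.toEuclideanLin U x) = inner ℂ x x := by
    rw [← LinearMap.adjoint_inner_right, ← Matrix.toEuclideanLin_conjTranspose_eq_adjoint,
      ← LinearMap.comp_apply, ← Matrix.toLpLin_mul_same, hU]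
    simp
  rw [← sq_eq_sq₀ (norm_nonneg _) (norm_nonneg _), ← @inner_self_eq_norm_sq ℂ, h,
    @inner_self_eq_norm_sq ℂ]

/-- The matrix of the isometry `|x⟩ ↦ |x⟩ ⊗ |M_x⟩`. -/
def stepMat (M : Matrix V V ℝ) : Matrix (V × V) V ℂ :=
  Matrix.of fun p x => psVec M x p

lemma stepMat_apply (M : Matrix V V ℝ) (p : V × V) (x : V) :
    stepMat M p x = if p.1 = x then ((√(M x p.2) : ℝ) : ℂ) else 0 := rfl

lemma swapMat_mul_apply {ι : Type*} (B : Matrix (V × V) ι ℂ) (p : V × V) (x : ι) :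
    (swapMat V * B) p x = B (p.2, p.1) x := by
  rw [Matrix.mul_apply, Finset.sum_eq_single (p.2, p.1)]
  · simp [swapMat]
  · rintro ⟨a, b⟩ - hne
    have : ¬ (p.1 = b ∧ p.2 = a) := fun h => hne (by rw [h.1, h.2])
    simp [swapMat, this]
  · simp

lemma swapMat_mul_swapMat : swapMat V * swapMat V = 1 := by
  ext p q
  rw [swapMat_mul_apply, Matrix.one_apply]
  simp only [swapMat, Matrix.of_apply, Prod.ext_iff]
  exact if_congr and_comm rfl rfl

lemma swapMat_conjTranspose : (swapMat V).conjTranspose = swapMat V := by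
  ext p q
  simp only [swapMat, Matrix.conjTranspose_apply, Matrix.of_apply]
  rw [apply_ite star, star_one, star_zero]
  exact if_congr ⟨fun h => ⟨h.2.symm, h.1.symm⟩, fun h => ⟨h.2.symm, h.1.symm⟩⟩ rfl rfl

lemma stepMat_conjTranspose_mul_self {M : Matrix V V ℝ} (h0 : ∀ x y, 0 ≤ M x y)
    (h1 : ∀ x, ∑ y, M x y = 1) : (stepMat M).conjTranspose * stepMat M = 1 := by
  ext x y
  rw [Matrix.mul_apply, Fintype.sum_prod_type, Finset.sum_eq_single x]
  · by_cases hxy : x = y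
    · subst hxy
      simp only [Matrix.conjTranspose_apply, stepMat_apply, if_true, Matrix.one_apply,
        RCLike.star_def, Complex.conj_ofReal, ← Complex.ofReal_mul, Real.mul_self_sqrt (h0 _ _)]
      rw [← Complex.ofReal_sum, h1, Complex.ofReal_one]
    · simp [stepMat_apply, hxy]
  · intro b _ hb
    simp [stepMat_apply, hb]
  · simp

lemma projA_eq (M : Matrix V V ℝ) : projA M = stepMat M * (stepMat M).conjTranspose := by
  ext p q
  simp [projA, Matrix.mul_apply, stepMat]

/-- The complex discriminant matrix of a walk. -/
def discrC (M : Matrix V V ℝ) : Matrix V V ℂ :=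
  (stepMat M).conjTranspose * (swapMat V * stepMat M)

lemma discrC_apply (M : Matrix V V ℝ) (x y : V) :
    discrC M x y = ((√(M x y) * √(M y x) : ℝ) : ℂ) := by
  rw [discrC, Matrix.mul_apply, Finset.sum_eq_single (x, y)]
  · simp [swapMat_mul_apply, stepMat_apply]
  · rintro ⟨a, b⟩ - hne
    rw [swapMat_mul_apply, Matrix.conjTranspose_apply, stepMat_apply, stepMat_apply]
    by_cases ha : a = x
    · have hb : b ≠ y := fun hb => hne (by rw [ha, hb])
      simp [hb]
    · simp [ha]
  · simp

lemma Wmat_mul_stepMat {M : Matrix V V ℝ} (h0 : ∀ x y, 0 ≤ M x y) (h1 : ∀ x, ∑ y, M x y = 1) :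
    Wmat M * stepMat M = swapMat V * stepMat M := by
  rw [Wmat, projA_eq, Matrix.mul_assoc, Matrix.sub_mul, Matrix.smul_mul, Matrix.mul_assoc,
    stepMat_conjTranspose_mul_self h0 h1, Matrix.mul_one, Matrix.one_mul, two_smul,
    add_sub_cancel_right]

lemma Wmat_mul_swapMat_mul_stepMat (M : Matrix V V ℝ) :
    Wmat M * (swapMat V * stepMat M) =
      (2 : ℂ) • (swapMat V * stepMat M * discrC M) - stepMat M := by
  rw [Wmat, projA_eq, Matrix.mul_assoc, Matrix.sub_mul, Matrix.smul_mul, Matrix.one_mul,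
    Matrix.mul_sub, ← Matrix.mul_assoc (swapMat V) (swapMat V), swapMat_mul_swapMat,
    Matrix.one_mul, Matrix.mul_smul, discrC]
  simp only [Matrix.mul_assoc]

lemma Wmat_conjTranspose_mul_self {M : Matrix V V ℝ} (h0 : ∀ x y, 0 ≤ M x y)
    (h1 : ∀ x, ∑ y, M x y = 1) : (Wmat M).conjTranspose * Wmat M = 1 := by
  have hp : projA M * projA M = projA M := by
    rw [projA_eq, Matrix.mul_assoc, ← Matrix.mul_assoc _ (stepMat M),
      stepMat_conjTranspose_mul_self h0 h1, Matrix.one_mul]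
  have hh : (projA M).conjTranspose = projA M := by
    rw [projA_eq, Matrix.conjTranspose_mul, Matrix.conjTranspose_conjTranspose]
  rw [Wmat, Matrix.conjTranspose_mul, swapMat_conjTranspose, Matrix.mul_assoc,
    ← Matrix.mul_assoc (swapMat V), swapMat_mul_swapMat, Matrix.one_mul,
    Matrix.conjTranspose_sub, Matrix.conjTranspose_smul, hh, Matrix.conjTranspose_one,
    show star (2 : ℂ) = 2 by simp, Matrix.sub_mul, Matrix.mul_sub, Matrix.smul_mul,
    Matrix.mul_smul, hp, Matrix.one_mul, Matrix.mul_one]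
  module

lemma l2norm_eq_norm {ι : Type*} [Fintype ι] (v : ι → ℂ) : l2norm v = ‖WithLp.toLp 2 v‖ := by
  simp [l2norm, EuclideanSpace.norm_eq, Complex.normSq_eq_norm_sq]

lemma sq_sqrt_sub_sqrt_le {a b : ℝ} (ha : 0 ≤ a) (hb : 0 ≤ b) : (√a - √b) ^ 2 ≤ |a - b| := by
  have e : a - b = (√a - √b) * (√a + √b) := by
    rw [mul_comm, ← sq_sub_sq, Real.sq_sqrt ha, Real.sq_sqrt hb]
  rw [e, abs_mul, ← sq_abs, sq, abs_of_nonneg (by positivity : 0 ≤ √a + √b)]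
  refine mul_le_mul_of_nonneg_left ?_ (abs_nonneg _)
  have := Real.sqrt_nonneg a
  have := Real.sqrt_nonneg b
  rw [abs_le]; constructor <;> linarith

/-- Szegedy's walks of a stochastic matrix `M` and its lazy version `(1 - ε) M + ε I` stay close on
a vector of small discriminant energy. -/
theorem norm_Wmat_pow_sub_le {M M' : Matrix V V ℝ} {ε γ : ℝ} (hε0 : 0 ≤ ε) (hε1 : ε ≤ 1)
    (h0 : ∀ x y, 0 ≤ M x y) (h1 : ∀ x, ∑ y, M x y = 1)
    (hM' : M' = (1 - ε) • M + ε • (1 : Matrix V V ℝ)) {v : EuclideanSpace ℂ V} (hv1 : ‖v‖ = 1)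
    (hv : (inner ℂ v (v - Matrix.toEuclideanLin (discrC M) v)).re ≤ γ) (t : ℕ) :
    l2norm ((Wmat M ^ t).mulVec ((stepMat M).mulVec v) -
        (Wmat M' ^ t).mulVec ((stepMat M').mulVec v)) ≤
      (2 + 36 * (t + 1) * ε) * √γ + 2 * √(2 * ε) := by
  set r := √(1 - ε) with hr
  have hr0 : 0 ≤ r := Real.sqrt_nonneg _
  have hr2 : r ^ 2 = 1 - ε := Real.sq_sqrt (by linarith)
  have hr1 : r ≤ 1 := Real.sqrt_le_one.2 (by linarith)
  have hM'a : ∀ x y, M' x y = (1 - ε) * M x y + ε * (1 : Matrix V V ℝ) x y := fun x y => by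
    rw [hM']; simp
  have hone : ∀ x y : V, 0 ≤ (1 : Matrix V V ℝ) x y := fun x y => by
    rw [Matrix.one_apply]; split_ifs <;> norm_num
  have hone1 : ∀ x : V, ∑ y, (1 : Matrix V V ℝ) x y = 1 := fun x => by
    simp [Matrix.one_apply]
  have h0' : ∀ x y, 0 ≤ M' x y := fun x y => by
    rw [hM'a]
    exact add_nonneg (mul_nonneg (by linarith) (h0 x y)) (mul_nonneg hε0 (hone x y))
  have h1' : ∀ x, ∑ y, M' x y = 1 := fun x => by
    simp only [hM'a, Finset.sum_add_distrib, ← Finset.mul_sum, h1, hone1]; ring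
  have hoff : ∀ x y, x ≠ y → √(M' x y) = r * √(M x y) := fun x y hxy => by
    rw [hM'a, Matrix.one_apply_ne hxy, mul_zero, add_zero, Real.sqrt_mul (by linarith)]
  have hWS : ∀ (X : Matrix V V ℝ) (x : EuclideanSpace ℂ V),
      Matrix.toEuclideanLin (Wmat X)
        (Matrix.toEuclideanLin (swapMat V) (Matrix.toEuclideanLin (stepMat X) x)) =
      (2 : ℂ) • Matrix.toEuclideanLin (swapMat V) (Matrix.toEuclideanLin (stepMat X)
        (Matrix.toEuclideanLin (discrC X) x)) - Matrix.toEuclideanLin (stepMat X) x := by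
    intro X x
    rw [toEuclideanLin_apply_apply (swapMat V) (stepMat X) x, toEuclideanLin_apply_apply (Wmat X),
      Wmat_mul_swapMat_mul_stepMat, toEuclideanLin_apply_apply (stepMat X),
      toEuclideanLin_apply_apply (swapMat V), map_sub, map_smul, LinearMap.sub_apply,
      LinearMap.smul_apply, Matrix.mul_assoc]
  have key := norm_walk_sub_walk_le (A := Matrix.toEuclideanLin (stepMat M))
    (A' := Matrix.toEuclideanLin (stepMat M')) (S := Matrix.toEuclideanLin (swapMat V))
    (W := Matrix.toEuclideanLin (Wmat M)) (W' := Matrix.toEuclideanLin (Wmat M'))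
    (D := Matrix.toEuclideanLin (discrC M)) (D' := Matrix.toEuclideanLin (discrC M'))
    (r := r) (η := √(2 * ε)) (γ := γ) hr0 hr1 (Real.sqrt_nonneg _)
    (norm_toEuclideanLin_apply (stepMat_conjTranspose_mul_self h0 h1))
    (norm_toEuclideanLin_apply (stepMat_conjTranspose_mul_self h0' h1'))
    (norm_toEuclideanLin_apply (by rw [swapMat_conjTranspose, swapMat_mul_swapMat]))
    (by
      rw [Matrix.isSymmetric_toEuclideanLin_iff]
      ext x y
      rw [Matrix.conjTranspose_apply, discrC_apply, discrC_apply, RCLike.star_def,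
        Complex.conj_ofReal, mul_comm])
    (fun x y => by
      rw [discrC, ← toEuclideanLin_apply_apply, Matrix.toEuclideanLin_conjTranspose_eq_adjoint,
        LinearMap.adjoint_inner_right, toEuclideanLin_apply_apply])
    (fun x => by
      have h : (1 : Matrix V V ℂ) - discrC M' = ((r ^ 2 : ℝ) : ℂ) • (1 - discrC M) := by
        ext x y
        rw [Matrix.sub_apply, Matrix.smul_apply, Matrix.sub_apply, discrC_apply, discrC_apply]
        by_cases hxy : x = y
        · subst hxy
          rw [Real.mul_self_sqrt (h0' _ _), Real.mul_self_sqrt (h0 _ _), hM'a, hr2]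
          simp only [Matrix.one_apply_eq, smul_eq_mul]
          push_cast; ring
        · rw [hoff x y hxy, hoff y x (Ne.symm hxy), Matrix.one_apply_ne hxy]
          simp only [smul_eq_mul]
          push_cast; ring
      have h2 := congrArg (fun X => Matrix.toEuclideanLin X x) h
      simpa [Matrix.toLpLin_one] using h2)
    (fun x => by rw [toEuclideanLin_apply_apply, toEuclideanLin_apply_apply, Wmat_mul_stepMat h0 h1])
    (hWS M)
    (fun x => by rw [toEuclideanLin_apply_apply, toEuclideanLin_apply_apply, Wmat_mul_stepMat h0' h1'])
    (hWS M')
    (norm_toEuclideanLin_apply (Wmat_conjTranspose_mul_self h0 h1))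
    (norm_toEuclideanLin_apply (Wmat_conjTranspose_mul_self h0' h1'))
    (fun x => by
      have h : swapMat V * stepMat M' - stepMat M' =
          (r : ℂ) • (swapMat V * stepMat M - stepMat M) := by
        ext ⟨a, b⟩ x
        simp only [Matrix.sub_apply, Matrix.smul_apply, swapMat_mul_apply, stepMat_apply,
          smul_eq_mul]
        by_cases hab : a = b
        · subst hab; simp
        · by_cases ha : a = x
          · subst ha
            simp [Ne.symm hab, hoff a b hab]
          · by_cases hb : b = x
            · subst hb
              simp [hab, hoff b a (Ne.symm hab)]
            · simp [ha, hb]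
      have h2 := congrArg (fun X => Matrix.toEuclideanLin X x) h
      rw [toEuclideanLin_apply_apply, toEuclideanLin_apply_apply]
      simpa only [map_sub, map_smul, LinearMap.sub_apply, LinearMap.smul_apply] using h2)
    (fun x => by
      refine le_of_sq_le_sq ?_ (by positivity)
      rw [mul_pow, Real.sq_sqrt (by positivity), EuclideanSpace.norm_sq_eq,
        EuclideanSpace.norm_sq_eq, Fintype.sum_prod_type, Finset.mul_sum]
      refine Finset.sum_le_sum fun a _ => ?_
      have hA : ∀ (X : Matrix V V ℝ) (b : V), Matrix.toEuclideanLin (stepMat X) x (a, b) =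
          (√(X a b) : ℝ) * x a := by
        intro X b
        simp [Matrix.toLpLin_apply, Matrix.mulVec, dotProduct, stepMat_apply]
      have hb : ∀ b, ‖(Matrix.toEuclideanLin (stepMat M) x -
          Matrix.toEuclideanLin (stepMat M') x) (a, b)‖ ^ 2 ≤
          (ε * M a b + ε * (1 : Matrix V V ℝ) a b) * ‖x a‖ ^ 2 := by
        intro b
        rw [PiLp.sub_apply, hA, hA, ← sub_mul, ← Complex.ofReal_sub, norm_mul, mul_pow,
          Complex.norm_real, Real.norm_eq_abs, sq_abs]
        refine mul_le_mul_of_nonneg_right ?_ (sq_nonneg _)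
        refine (sq_sqrt_sub_sqrt_le (h0 a b) (h0' a b)).trans ?_
        have n1 := mul_nonneg hε0 (h0 a b)
        have n2 := mul_nonneg hε0 (hone a b)
        rw [hM'a, abs_le]
        constructor <;> linarith
      refine (Finset.sum_le_sum fun b _ => hb b).trans (le_of_eq ?_)
      rw [← Finset.sum_mul, Finset.sum_add_distrib, ← Finset.mul_sum, ← Finset.mul_sum, h1, hone1]
      ring)
    hv1 hv t
  have hpow : ∀ (X : Matrix V V ℝ), (Matrix.toEuclideanLin (Wmat X) ^ t)
      (Matrix.toEuclideanLin (stepMat X) v) =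
      WithLp.toLp 2 ((Wmat X ^ t).mulVec ((stepMat X).mulVec v)) := by
    intro X
    rw [← Matrix.toLpLin_pow, Matrix.toLpLin_apply, Matrix.toLpLin_apply]
  rw [l2norm_eq_norm, WithLp.toLp_sub, ← hpow, ← hpow]
  refine key.trans ?_
  have hrε : 1 - r ≤ ε := by nlinarith
  gcongr

end Szegedy

section Interpolated

variable {M : Matrix V V ℝ} {s : ℝ}

lemma interp_apply (M : Matrix V V ℝ) (m : V) (s : ℝ) (x y : V) :
    interp M m s x y = if x = m then (1 - s) * M x y + s * (1 : Matrix V V ℝ) x y else M x y := by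
  by_cases hx : x = m
  · subst hx
    simp [interp, absorb, Matrix.one_apply, eq_comm]
  · simp only [interp, absorb, Matrix.add_apply, Matrix.smul_apply, Matrix.of_apply, smul_eq_mul,
      if_neg hx]
    ring

lemma interp_nonneg (h0 : ∀ x y, 0 ≤ M x y) (hs0 : 0 ≤ s) (hs1 : s ≤ 1) (m x y : V) :
    0 ≤ interp M m s x y := by
  have h1 : 0 ≤ (1 : Matrix V V ℝ) x y := by
    rw [Matrix.one_apply]; split_ifs <;> norm_num
  have h2 := h0 x y
  have h3 : 0 ≤ 1 - s := by linarith
  rw [interp_apply]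
  split_ifs <;> positivity

lemma interp_sum (h1 : ∀ x, ∑ y, M x y = 1) (m x : V) : ∑ y, interp M m s x y = 1 := by
  simp only [interp_apply]
  split_ifs
  · rw [Finset.sum_add_distrib, ← Finset.mul_sum, ← Finset.mul_sum, h1]
    simp [Matrix.one_apply]
  · exact h1 x

lemma interp_lazyP (G : SimpleGraph V) [DecidableRel G.Adj] {d : ℕ} (hd : 1 ≤ d) (m : V) :
    interp (lazyP G d ((d : ℝ) / (Fintype.card V : ℝ))) m (1 - 1 / (Fintype.card V : ℝ)) =
      (1 - 1 / ((Fintype.card V : ℝ) + 1)) •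
          interp (Pmat G d) m (1 - 1 / (Fintype.card V : ℝ)) +
        (1 / ((Fintype.card V : ℝ) + 1)) • (1 : Matrix V V ℝ) := by
  have hd' : (0 : ℝ) < d := by exact_mod_cast hd
  have hN : (0 : ℝ) < Fintype.card V := by
    exact_mod_cast Fintype.card_pos_iff.2 ⟨m⟩
  ext x y
  simp only [interp_apply, lazyP, Matrix.add_apply, Matrix.smul_apply, smul_eq_mul]
  split_ifs <;> field_simp <;> ring

lemma initIp_eq (M : Matrix V V ℝ) (m : V) :
    initIp M m = (stepMat M).mulVec fun x => ((sqrtPiBar m x : ℝ) : ℂ) := by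
  ext p
  simp only [initIp, Matrix.mulVec, dotProduct, stepMat_apply, sqrtPiBar, ite_mul, zero_mul,
    Finset.sum_ite_eq, Finset.mem_univ, if_true]
  split_ifs
  · simp
  · rw [mul_comm]

lemma sqrtPiBar_sq (hN : 3 ≤ Fintype.card V) (m x : V) :
    sqrtPiBar m x ^ 2 = if x = m then 0 else 1 / ((Fintype.card V : ℝ) - 1) := by
  have hN' : (3 : ℝ) ≤ Fintype.card V := by exact_mod_cast hN
  rw [sqrtPiBar]
  split_ifs
  · simp
  · rw [div_pow, Real.sq_sqrt (by linarith), one_pow]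

lemma sum_sqrtPiBar_sq (hN : 3 ≤ Fintype.card V) (m : V) : ∑ x, sqrtPiBar m x ^ 2 = 1 := by
  have hN' : (3 : ℝ) ≤ Fintype.card V := by exact_mod_cast hN
  simp only [sqrtPiBar_sq hN]
  rw [← Finset.add_sum_erase _ _ (Finset.mem_univ m), if_pos rfl, zero_add,
    Finset.sum_congr rfl fun x hx => if_neg (Finset.ne_of_mem_erase hx), Finset.sum_const,
    Finset.card_erase_of_mem (Finset.mem_univ m), Finset.card_univ, nsmul_eq_mul,
    Nat.cast_sub (by omega), Nat.cast_one]
  field_simp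
  exact div_self (by linarith)

lemma sum_sqrtPiBar_mul_Pmat {G : SimpleGraph V} [DecidableRel G.Adj] {d : ℕ} (hd : 1 ≤ d)
    (hreg : G.IsRegularOfDegree d) (hN : 3 ≤ Fintype.card V) (m : V) :
    ∑ x, ∑ y, sqrtPiBar m x * sqrtPiBar m y * Pmat G d x y =
      1 - 1 / ((Fintype.card V : ℝ) - 1) := by
  have hN' : (3 : ℝ) ≤ Fintype.card V := by exact_mod_cast hN
  have hrow : ∀ x, ∑ y, sqrtPiBar m x * sqrtPiBar m y * Pmat G d x y =
      sqrtPiBar m x ^ 2 - 1 / ((Fintype.card V : ℝ) - 1) * Pmat G d x m := by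
    intro x
    by_cases hx : x = m
    · subst hx
      simp [sqrtPiBar, Pmat]
    · have h : ∀ y, sqrtPiBar m x * sqrtPiBar m y * Pmat G d x y =
          sqrtPiBar m x ^ 2 * (Pmat G d x y - if y = m then Pmat G d x m else 0) := by
        intro y
        by_cases hy : y = m
        · simp [sqrtPiBar, hy]
        · simp only [sqrtPiBar, hx, hy, if_false]; ring
      simp only [h]
      rw [← Finset.mul_sum, Finset.sum_sub_distrib, Pmat_sum hd hreg, Finset.sum_ite_eq',
        if_pos (Finset.mem_univ m), sqrtPiBar_sq hN, if_neg hx]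
      ring
  simp only [hrow]
  rw [Finset.sum_sub_distrib, sum_sqrtPiBar_sq hN, ← Finset.mul_sum]
  simp only [Pmat_comm _ m]
  rw [Pmat_sum hd hreg, mul_one]

lemma energy_sqrtPiBar {G : SimpleGraph V} [DecidableRel G.Adj] {d : ℕ} (hd : 1 ≤ d)
    (hreg : G.IsRegularOfDegree d) (hN : 3 ≤ Fintype.card V) (m : V) (s : ℝ)
    {v : EuclideanSpace ℂ V} (hv : v = WithLp.toLp 2 fun x => ((sqrtPiBar m x : ℝ) : ℂ)) :
    (inner ℂ v (v - Matrix.toEuclideanLin (discrC (interp (Pmat G d) m s)) v)).re =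
      1 / ((Fintype.card V : ℝ) - 1) := by
  have hin : inner ℂ v v = ((1 : ℝ) : ℂ) := by
    rw [← sum_sqrtPiBar_sq hN m, PiLp.inner_apply, hv, Complex.ofReal_sum]
    refine Finset.sum_congr rfl fun x _ => ?_
    rw [RCLike.inner_apply, Complex.conj_ofReal, pow_two, Complex.ofReal_mul]
  have hD : inner ℂ v (Matrix.toEuclideanLin (discrC (interp (Pmat G d) m s)) v) =
      ((1 - 1 / ((Fintype.card V : ℝ) - 1) : ℝ) : ℂ) := by
    rw [← sum_sqrtPiBar_mul_Pmat hd hreg hN m, PiLp.inner_apply, hv, Complex.ofReal_sum]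
    refine Finset.sum_congr rfl fun x _ => ?_
    rw [Matrix.toLpLin_apply, Complex.ofReal_sum]
    simp only [Matrix.mulVec, dotProduct, discrC_apply, RCLike.inner_apply,
      Complex.conj_ofReal]
    rw [Finset.sum_mul]
    refine Finset.sum_congr rfl fun y _ => ?_
    by_cases hx : x = m
    · simp [sqrtPiBar, hx]
    by_cases hy : y = m
    · simp [sqrtPiBar, hy]
    rw [interp_apply, interp_apply, if_neg hx, if_neg hy, Pmat_comm y x,
      Real.mul_self_sqrt (Pmat_nonneg x y)]
    push_cast; ring
  rw [inner_sub_right, hin, hD, ← Complex.ofReal_sub, Complex.ofReal_re]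
  ring

end Interpolated

end Helpers

theorem statement_17 :
    ∀ c : ℝ, 1 ≤ c → ∃ K > (0 : ℝ),
      ∀ (V : Type) [Fintype V] [DecidableEq V]
        (G : SimpleGraph V) [DecidableRel G.Adj] (d : ℕ) (m : V),
        1 ≤ d → 3 ≤ Fintype.card V → G.Connected → G.IsRegularOfDegree d →
        ∀ Ps Pshat : Matrix V V ℝ,
          Ps = interp (Pmat G d) m (1 - 1 / (Fintype.card V : ℝ)) →
          Pshat = interp (lazyP G d ((d : ℝ) / (Fintype.card V : ℝ))) m
            (1 - 1 / (Fintype.card V : ℝ)) →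
          ∀ t : ℕ,
            (t : ℝ) ≤ c * Real.sqrt (hittingTime (Pmat G d) m) →
            l2norm ((Wmat Ps ^ t).mulVec (initIp Ps m)
                - (Wmat Pshat ^ t).mulVec (initIp Pshat m))
              ≤ K / (Fintype.card V : ℝ) ^ ((1 : ℝ) / 4) := by
  intro c hc
  refine ⟨2 * (4 + 108 * c), by positivity, ?_⟩
  intro V _ _ G _ d m hd hN hG hreg Ps Pshat hPs hPshat t ht
  set N : ℝ := (Fintype.card V : ℝ) with hNdef
  have hN3 : (3 : ℝ) ≤ N := by rw [hNdef]; exact_mod_cast hN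
  have hN0 : 0 < N := by linarith
  have hinv : 1 / N ≤ 1 := by rw [div_le_one hN0]; linarith
  have hinv0 : 0 ≤ 1 / N := by positivity
  have hε1 : 1 / (N + 1) ≤ 1 := by rw [div_le_one (by linarith)]; linarith
  have hε0 : 0 ≤ 1 / (N + 1) := by positivity
  set v : EuclideanSpace ℂ V := WithLp.toLp 2 fun x => ((sqrtPiBar m x : ℝ) : ℂ) with hv
  have hv1 : ‖v‖ = 1 := by
    rw [EuclideanSpace.norm_eq, Real.sqrt_eq_one, ← sum_sqrtPiBar_sq hN m]
    refine Finset.sum_congr rfl fun x _ => ?_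
    rw [hv, Complex.norm_real, Real.norm_eq_abs, sq_abs]
  have hwalk := norm_Wmat_pow_sub_le (M' := Pshat) hε0 hε1
    (interp_nonneg (s := 1 - 1 / N) (Pmat_nonneg (G := G) (d := d)) (by linarith) (by linarith) m)
    (interp_sum (Pmat_sum hd hreg) m) (hPshat.trans (interp_lazyP G hd m)) hv1
    (energy_sqrtPiBar hd hreg hN m (1 - 1 / N) hv).le t
  rw [← hPs] at hwalk
  rw [initIp_eq, initIp_eq]
  refine hwalk.trans ?_
  have hHT : √(hittingTime (Pmat G d) m) ≤ 3 * N := by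
    rw [Real.sqrt_le_left (by positivity)]
    refine (hittingTime_Pmat_le hG hd hreg m).trans ?_
    rw [mul_pow]
    nlinarith [sq_nonneg N]
  have ht' : ((t : ℝ) + 1) * (1 / (N + 1)) ≤ 3 * c := by
    rw [mul_one_div, div_le_iff₀ (by linarith)]
    nlinarith [mul_le_mul_of_nonneg_left hHT (zero_le_one.trans hc)]
  have hcoef : 36 * ((t : ℝ) + 1) * (1 / (N + 1)) ≤ 108 * c := by
    rw [mul_assoc]; linarith
  have hq : √(2 / N) ≤ 2 / N ^ ((1 : ℝ) / 4) := by
    rw [Real.sqrt_le_left (by positivity)]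
    have hq1 : 1 ≤ N ^ ((1 : ℝ) / 4) := Real.one_le_rpow (by linarith) (by norm_num)
    have hq4 : (N ^ ((1 : ℝ) / 4)) ^ 4 = N := by
      rw [← Real.rpow_natCast, ← Real.rpow_mul hN0.le]
      norm_num
    set q := N ^ ((1 : ℝ) / 4)
    rw [← hq4, div_pow, div_le_div_iff₀ (by positivity) (by positivity)]
    nlinarith [pow_le_pow_right₀ hq1 (show 2 ≤ 4 by norm_num), pow_pos (zero_lt_one.trans_le hq1) 4]
  have hγ : √(1 / (N - 1)) ≤ √(2 / N) := by
    refine Real.sqrt_le_sqrt ?_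
    rw [div_le_div_iff₀ (by linarith) hN0]
    linarith
  have hε : √(2 * (1 / (N + 1))) ≤ √(2 / N) := by
    refine Real.sqrt_le_sqrt ?_
    rw [mul_one_div]
    gcongr
    linarith
  calc (2 + 36 * ((t : ℝ) + 1) * (1 / (N + 1))) * √(1 / (N - 1)) + 2 * √(2 * (1 / (N + 1)))
      ≤ (2 + 108 * c) * √(2 / N) + 2 * √(2 / N) := by
        gcongr
    _ = (4 + 108 * c) * √(2 / N) := by ring
    _ ≤ (4 + 108 * c) * (2 / N ^ ((1 : ℝ) / 4)) := by gcongr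
    _ = 2 * (4 + 108 * c) / N ^ ((1 : ℝ) / 4) := by ring

end LQWPaper
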